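/- Subdivision and parallel-edge operations preserve coprimality: if (G', e') is obtained from a marked graph (G, e) by replacing e with a path of length k+1 (marking a new edge), then gcd(τ(G'−e'), τ(G'/e')) = gcd(τ(G−e), τ(G/e)). -/

import Mathlib

/-- A finite multigraph without loops: edges are oriented pairs of distinct vertices;
parallel edges are allowed since `E` is an arbitrary type. -/
structure Multigraph (V E : Type) where
  fst : E → V
  snd : E → V
  no_loop : ∀ e, fst e ≠ snd e

namespace Multigraph

variable {V E : Type}

/-- The simple graph on `V` whose edges are the (unordered) endpoint pairs of the
edges in the set `T`. -/
def simpleOf (M : Multigraph V E) (T : Set E) : SimpleGraph V :=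
  SimpleGraph.fromEdgeSet {s | ∃ e ∈ T, s = s(M.fst e, M.snd e)}

/-- `T` is a spanning tree of the multigraph `M`: it connects all the vertices and
has exactly `|V| - 1` edges. -/
def IsSpanningTree (M : Multigraph V E) (T : Set E) : Prop :=
  (M.simpleOf T).Connected ∧ T.ncard = Nat.card V - 1

/-- The number of spanning trees of the multigraph `M`. -/
noncomputable def tau (M : Multigraph V E) : ℕ :=
  Nat.card {T : Set E // M.IsSpanningTree T}

/-- Deletion of the edge `e`. -/
def delete (M : Multigraph V E) (e : E) : Multigraph V {e' : E // e' ≠ e} where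
  fst e' := M.fst e'.1
  snd e' := M.snd e'.1
  no_loop e' := M.no_loop e'.1

open Classical in
/-- The map sending `snd e` to `fst e` and fixing all other vertices. -/
noncomputable def contractMap (M : Multigraph V E) (e : E) (v : V) :
    {w : V // w ≠ M.snd e} :=
  if h : v = M.snd e then ⟨M.fst e, M.no_loop e⟩ else ⟨v, h⟩

/-- Contraction of the edge `e`: the endpoints of `e` are identified, and the
resulting loops (including `e` itself) are removed. -/
noncomputable def contract (M : Multigraph V E) (e : E) :
    Multigraph {w : V // w ≠ M.snd e}
      {e' : E // e' ≠ e ∧ M.contractMap e (M.fst e') ≠ M.contractMap e (M.snd e')} where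
  fst e' := M.contractMap e (M.fst e'.1)
  snd e' := M.contractMap e (M.snd e'.1)
  no_loop e' := e'.2.2

/-- The multigraph is simple: distinct edges have distinct endpoint pairs. -/
def Simple (M : Multigraph V E) : Prop :=
  ∀ e₁ e₂ : E, s(M.fst e₁, M.snd e₁) = s(M.fst e₂, M.snd e₂) → e₁ = e₂

end Multigraph

namespace Multigraph

variable {V E : Type}

/-- The subdivision operation `f^k`: replace the edge `e` by a path with `k+1` edges
through `k` new internal vertices. The new path edges are indexed by `Fin (k+1)`. -/
def subdivide (M : Multigraph V E) (e : E) (k : ℕ) :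
    Multigraph (V ⊕ Fin k) ({e' : E // e' ≠ e} ⊕ Fin (k + 1)) where
  fst x :=
    match x with
    | .inl e' => .inl (M.fst e'.1)
    | .inr i =>
        if h : (i : ℕ) = 0 then .inl (M.fst e)
        else .inr ⟨(i : ℕ) - 1, by have := i.isLt; omega⟩
  snd x :=
    match x with
    | .inl e' => .inl (M.snd e'.1)
    | .inr i =>
        if h : (i : ℕ) = k then .inl (M.snd e)
        else .inr ⟨(i : ℕ), by have := i.isLt; omega⟩
  no_loop := by
    rintro (e' | i)
    · simpa using M.no_loop e'.1
    · dsimp only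
      split_ifs with h1 h2 <;> simp_all [M.no_loop e]
      omega

/-- The parallel-edge operation `g^k`: replace the edge `e` by `k+1` parallel copies,
indexed by `Fin (k+1)`. -/
def addParallel (M : Multigraph V E) (e : E) (k : ℕ) :
    Multigraph V ({e' : E // e' ≠ e} ⊕ Fin (k + 1)) where
  fst x := match x with | .inl e' => M.fst e'.1 | .inr _ => M.fst e
  snd x := match x with | .inl e' => M.snd e'.1 | .inr _ => M.snd e
  no_loop := by rintro (e' | i); exacts [M.no_loop e'.1, M.no_loop e]

end Multigraph

namespace Multigraph

variable {V E : Type}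

/-- Connectivity of the edge set `T`: every predicate invariant along `T` is constant. -/
theorem simpleOf_connected_iff (M : Multigraph V E) (T : Set E) :
    (M.simpleOf T).Connected ↔ Nonempty V ∧
      ∀ f : V → Prop, (∀ t ∈ T, f (M.fst t) ↔ f (M.snd t)) → ∀ x y, f x ↔ f y := by
  rw [SimpleGraph.connected_iff, and_comm]
  refine and_congr_right fun _ => ⟨fun h f hf x y => ?_, fun h x y => ?_⟩
  · obtain ⟨p⟩ := h x y
    induction p with
    | nil => rfl
    | cons hadj _ ih =>
      refine Iff.trans ?_ ih
      rw [simpleOf, SimpleGraph.fromEdgeSet_adj] at hadj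
      obtain ⟨⟨t, ht, hs⟩, -⟩ := hadj
      rcases Sym2.eq_iff.1 hs with ⟨rfl, rfl⟩ | ⟨rfl, rfl⟩
      · exact hf t ht
      · exact (hf t ht).symm
  · refine (h (fun z => (M.simpleOf T).Reachable x z) (fun t ht => ?_) x y).1 (.refl x)
    have hadj : (M.simpleOf T).Adj (M.fst t) (M.snd t) := by
      rw [simpleOf, SimpleGraph.fromEdgeSet_adj]
      exact ⟨⟨t, ht, rfl⟩, M.no_loop t⟩
    exact ⟨fun h => h.trans hadj.reachable, fun h => h.trans hadj.symm.reachable⟩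

theorem card_le_ncard_add_one [Finite V] [Finite E] (M : Multigraph V E) (T : Set E)
    (h : (M.simpleOf T).Connected) : Nat.card V ≤ T.ncard + 1 := by
  refine h.card_vert_le_card_edgeSet_add_one.trans (Nat.add_le_add_right ?_ 1)
  rw [Nat.card_coe_set_eq]
  refine (Set.ncard_le_ncard (t := (fun t => s(M.fst t, M.snd t)) '' T) ?_).trans
    (Set.ncard_image_le T.toFinite)
  rw [simpleOf, SimpleGraph.edgeSet_fromEdgeSet]
  rintro s ⟨⟨t, ht, rfl⟩, -⟩
  exact ⟨t, ht, rfl⟩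

theorem two_le_card [Finite V] (M : Multigraph V E) (e : E) : 2 ≤ Nat.card V := by
  have : Nontrivial V := ⟨⟨_, _, M.no_loop e⟩⟩
  exact Finite.one_lt_card

theorem tau_eq_ncard (M : Multigraph V E) : M.tau = {T | M.IsSpanningTree T}.ncard := rfl

theorem delete_isSpanningTree_iff (M : Multigraph V E) (e : E) (T : Set {e' : E // e' ≠ e}) :
    (M.delete e).IsSpanningTree T ↔ M.IsSpanningTree (Subtype.val '' T) := by
  rw [IsSpanningTree, IsSpanningTree, simpleOf_connected_iff, simpleOf_connected_iff,
    Set.ncard_image_of_injective _ Subtype.val_injective]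
  simp [delete]

/-- The spanning trees of `M - e` are the spanning trees of `M` avoiding `e`. -/
theorem tau_delete (M : Multigraph V E) (e : E) :
    (M.delete e).tau = {T | M.IsSpanningTree T ∧ e ∉ T}.ncard := by
  rw [tau_eq_ncard, ← Set.ncard_image_of_injective _ Subtype.val_injective.image_injective]
  congr 1
  ext T
  simp only [Set.mem_image, Set.mem_ofPred_eq, delete_isSpanningTree_iff]
  constructor
  · rintro ⟨A, hA, rfl⟩
    exact ⟨hA, by simp⟩
  · rintro ⟨hT, he⟩
    have : Subtype.val '' (Subtype.val ⁻¹' T : Set {e' : E // e' ≠ e}) = T := by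
      ext t
      simp only [Set.mem_image, Set.mem_preimage, Subtype.exists, exists_and_left, exists_prop,
        exists_eq_right_right, and_iff_left_iff_imp]
      rintro ht rfl
      exact he ht
    exact ⟨_, by rwa [this], this⟩

theorem contractMap_fst (M : Multigraph V E) (e : E) :
    M.contractMap e (M.fst e) = ⟨M.fst e, M.no_loop e⟩ :=
  dif_neg (M.no_loop e)

theorem contractMap_snd (M : Multigraph V E) (e : E) :
    M.contractMap e (M.snd e) = ⟨M.fst e, M.no_loop e⟩ :=
  dif_pos rfl

theorem contractMap_val (M : Multigraph V E) (e : E) (v : {w : V // w ≠ M.snd e}) :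
    M.contractMap e v = v :=
  dif_neg v.2

theorem apply_contractMap_iff (M : Multigraph V E) (e : E) (f : V → Prop)
    (hf : f (M.fst e) ↔ f (M.snd e)) (v : V) : f (M.contractMap e v) ↔ f v := by
  by_cases h : v = M.snd e
  · rw [h, contractMap_snd, hf]
  · rw [contractMap, dif_neg h]

theorem contract_isSpanningTree_iff [Finite V] [Finite E] (M : Multigraph V E) (e : E)
    (T : Set {e' : E // e' ≠ e ∧ M.contractMap e (M.fst e') ≠ M.contractMap e (M.snd e')}) :
    (M.contract e).IsSpanningTree T ↔ M.IsSpanningTree (insert e (Subtype.val '' T)) := by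
  have hcard : Nat.card {w : V // w ≠ M.snd e} + 1 = Nat.card V := by
    have h := Set.ncard_add_ncard_compl {M.snd e}
    rw [Set.ncard_singleton] at h
    rw [← h, add_comm]
    rfl
  have hV := M.two_le_card e
  have he : e ∉ Subtype.val '' T := by simp
  rw [IsSpanningTree, IsSpanningTree, simpleOf_connected_iff, simpleOf_connected_iff,
    Set.ncard_insert_of_notMem he, Set.ncard_image_of_injective _ Subtype.val_injective]
  refine and_congr (and_congr (iff_of_true ⟨⟨_, M.no_loop e⟩⟩ ⟨M.fst e⟩) ⟨fun h f hf x y => ?_,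
    fun h f hf x y => ?_⟩) (by omega)
  · have hfe := hf e (Set.mem_insert _ _)
    rw [← apply_contractMap_iff M e f hfe x, ← apply_contractMap_iff M e f hfe y]
    refine h (fun v => f v) (fun t ht => ?_) _ _
    simp only [contract, apply_contractMap_iff M e f hfe]
    exact hf t (Set.mem_insert_of_mem _ ⟨t, ht, rfl⟩)
  · have := h (fun v => f (M.contractMap e v)) ?_ x y
    · simpa only [contractMap_val] using this
    · rintro _ (rfl | ⟨t, ht, rfl⟩)
      · rw [contractMap_fst, contractMap_snd]
      · exact hf t ht

/-- Two edges of a spanning tree are never parallel, so that no edge of a spanning tree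
through `e` becomes a loop in the contraction. -/
theorem IsSpanningTree.contractMap_ne [Finite V] [Finite E] {M : Multigraph V E} {T : Set E}
    (hT : M.IsSpanningTree T) {e t : E} (he : e ∈ T) (ht : t ∈ T) (hte : t ≠ e) :
    M.contractMap e (M.fst t) ≠ M.contractMap e (M.snd t) := by
  intro heq
  have hconn : (M.simpleOf (T \ {t})).Connected := by
    rw [simpleOf_connected_iff]
    refine ⟨⟨M.fst e⟩, fun f hf => ((M.simpleOf_connected_iff T).1 hT.1).2 f fun s hs => ?_⟩
    by_cases hst : s = t
    · have hfe := hf e ⟨he, hte.symm⟩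
      rw [hst, ← apply_contractMap_iff M e f hfe, heq, apply_contractMap_iff M e f hfe]
    · exact hf s ⟨hs, hst⟩
  have h1 := M.card_le_ncard_add_one _ hconn
  have h2 := Set.ncard_sdiff_singleton_add_one ht
  have h3 := M.two_le_card e
  have h4 := hT.2
  omega

/-- The spanning trees of `M / e` correspond to the spanning trees of `M` through `e`. -/
theorem tau_contract [Finite V] [Finite E] (M : Multigraph V E) (e : E) :
    (M.contract e).tau = {T | M.IsSpanningTree T ∧ e ∈ T}.ncard := by
  have hinj : Function.Injective fun T : Set {e' : E // e' ≠ e ∧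
      M.contractMap e (M.fst e') ≠ M.contractMap e (M.snd e')} =>
      insert e (Subtype.val '' T) := by
    intro A B h
    ext x
    have := Set.ext_iff.1 h x
    simpa [x.2.1, x.2.2] using this
  rw [tau_eq_ncard, ← Set.ncard_image_of_injective _ hinj]
  congr 1
  ext T
  simp only [Set.mem_image, Set.mem_ofPred_eq, contract_isSpanningTree_iff]
  constructor
  · rintro ⟨A, hA, rfl⟩
    exact ⟨hA, Set.mem_insert _ _⟩
  · rintro ⟨hT, he⟩
    have : insert e (Subtype.val '' (Subtype.val ⁻¹' T : Set {e' : E // e' ≠ e ∧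
        M.contractMap e (M.fst e') ≠ M.contractMap e (M.snd e')})) = T := by
      ext t
      by_cases hte : t = e
      · simp [hte, he]
      · rw [Set.mem_insert_iff, or_iff_right hte]
        refine ⟨?_, fun h => ⟨⟨t, hte, hT.contractMap_ne he h hte⟩, h, rfl⟩⟩
        rintro ⟨s, hs, rfl⟩
        exact hs
    exact ⟨_, by rwa [this], this⟩

/-- The edge set of a subdivision which agrees with `T` away from `e` and with `B` on the
new path. -/
def subdivideSet (e : E) {k : ℕ} (T : Set E) (B : Set (Fin (k + 1))) :
    Set ({e' : E // e' ≠ e} ⊕ Fin (k + 1)) :=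
  Sum.inl '' (Subtype.val ⁻¹' T) ∪ Sum.inr '' B

section subdivideSet

variable {e : E} {k : ℕ} {T : Set E} {B : Set (Fin (k + 1))}

@[simp] theorem inl_mem_subdivideSet {t : {e' : E // e' ≠ e}} :
    Sum.inl t ∈ subdivideSet e T B ↔ t.1 ∈ T := by
  simp [subdivideSet]

@[simp] theorem inr_mem_subdivideSet {j : Fin (k + 1)} :
    Sum.inr j ∈ subdivideSet e T B ↔ j ∈ B := by
  simp [subdivideSet]

theorem exists_eq_subdivideSet (e : E) (S : Set ({e' : E // e' ≠ e} ⊕ Fin (k + 1))) (p : Prop) :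
    ∃ T : Set E, (e ∈ T ↔ p) ∧ S = subdivideSet e T (Sum.inr ⁻¹' S) := by
  refine ⟨{x | (∃ h : x ≠ e, Sum.inl ⟨x, h⟩ ∈ S) ∨ x = e ∧ p}, by simp, ?_⟩
  ext (t | j)
  · simp [t.2]
  · simp

theorem subdivideSet_inj {T' : Set E} {B' : Set (Fin (k + 1))} (he : e ∈ T ↔ e ∈ T')
    (h : subdivideSet e T B = subdivideSet e T' B') : T = T' ∧ B = B' := by
  refine ⟨Set.ext fun t => ?_, Set.ext fun j => ?_⟩
  · by_cases hte : t = e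
    · rwa [hte]
    · simpa using Set.ext_iff.1 h (.inl ⟨t, hte⟩)
  · simpa using Set.ext_iff.1 h (.inr j)

theorem ncard_subdivideSet [Finite E] :
    (subdivideSet e T B).ncard = (T \ {e}).ncard + B.ncard := by
  rw [subdivideSet, Set.ncard_union_eq, Set.ncard_image_of_injective _ Sum.inl_injective,
    Set.ncard_image_of_injective _ Sum.inr_injective,
    ← Set.ncard_image_of_injective _ Subtype.val_injective]
  · congr 2
    ext t
    simp [and_comm]
  · rw [Set.disjoint_left]
    rintro _ ⟨t, -, rfl⟩ ⟨j, -, h⟩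
    simp at h

end subdivideSet

section subdivide

variable (M : Multigraph V E) (e : E) {k : ℕ}

theorem subdivide_fst_zero (h : 0 < k + 1) :
    (M.subdivide e k).fst (.inr ⟨0, h⟩) = .inl (M.fst e) := rfl

theorem subdivide_fst_succ (m : ℕ) (h : m + 1 < k + 1) :
    (M.subdivide e k).fst (.inr ⟨m + 1, h⟩) = .inr ⟨m, by omega⟩ := rfl

theorem subdivide_snd_last (h : k < k + 1) :
    (M.subdivide e k).snd (.inr ⟨k, h⟩) = .inl (M.snd e) := dif_pos rfl

theorem subdivide_snd_of_lt (m : ℕ) (h : m < k) :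
    (M.subdivide e k).snd (.inr ⟨m, by omega⟩) = .inr ⟨m, h⟩ := dif_neg h.ne

variable {M e} {f : V ⊕ Fin k → Prop}

theorem subdivide_apply_inr_iff_fst {j : ℕ} (hf : ∀ i : Fin (k + 1), i.1 < j →
    (f ((M.subdivide e k).fst (.inr i)) ↔ f ((M.subdivide e k).snd (.inr i)))) (m : ℕ)
    (hm : m < k) (hmj : m < j) : f (.inr ⟨m, hm⟩) ↔ f (.inl (M.fst e)) := by
  induction m with
  | zero =>
    have := hf ⟨0, by omega⟩ hmj
    rw [subdivide_fst_zero, subdivide_snd_of_lt M e 0 hm] at this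
    exact this.symm
  | succ m ih =>
    have := hf ⟨m + 1, by omega⟩ hmj
    rw [subdivide_fst_succ, subdivide_snd_of_lt M e _ hm] at this
    exact this.symm.trans (ih (by omega) (by omega))

theorem subdivide_apply_inr_iff_snd {j : ℕ} (hf : ∀ i : Fin (k + 1), j < i.1 →
    (f ((M.subdivide e k).fst (.inr i)) ↔ f ((M.subdivide e k).snd (.inr i)))) (m : ℕ)
    (hm : m < k) (hmj : j ≤ m) : f (.inr ⟨m, hm⟩) ↔ f (.inl (M.snd e)) := by
  have key := hf ⟨m + 1, by omega⟩ (Nat.lt_succ_of_le hmj)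
  rw [subdivide_fst_succ] at key
  refine key.trans ?_
  by_cases h : m + 1 = k
  · subst h
    rw [subdivide_snd_last]
  · rw [subdivide_snd_of_lt M e (m + 1) (by omega)]
    exact subdivide_apply_inr_iff_snd hf (m + 1) (by omega) (by omega)
termination_by k - m

variable (M)

/-- A connected edge set of the subdivision misses at most one edge of the new path. -/
theorem subdivide_not_connected {S : Set ({e' : E // e' ≠ e} ⊕ Fin (k + 1))}
    {j₁ j₂ : Fin (k + 1)} (hlt : j₁ < j₂) (h₁ : Sum.inr j₁ ∉ S) (h₂ : Sum.inr j₂ ∉ S) :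
    ¬ ((M.subdivide e k).simpleOf S).Connected := by
  rw [simpleOf_connected_iff]
  rintro ⟨-, h⟩
  have hlt' : j₁.1 < j₂.1 := hlt
  have hj := j₂.2
  have := h (Sum.elim (fun _ => False) fun m => j₁.1 ≤ m.1 ∧ m.1 < j₂.1) ?_
    (.inl (M.fst e)) (.inr ⟨j₁, by omega⟩)
  · simp [hlt'] at this
  · rintro (t | i) ht
    · simp [subdivide]
    · have hi₁ : i.1 ≠ j₁.1 := fun h => h₁ (Fin.ext h ▸ ht)
      have hi₂ : i.1 ≠ j₂.1 := fun h => h₂ (Fin.ext h ▸ ht)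
      have := i.2
      simp only [subdivide]
      split_ifs <;> simp only [Sum.elim_inl, Sum.elim_inr, false_iff, iff_false] <;> omega

theorem IsSpanningTree.eq_of_notMem_subdivide {S : Set ({e' : E // e' ≠ e} ⊕ Fin (k + 1))}
    (hS : (M.subdivide e k).IsSpanningTree S) {j₁ j₂ : Fin (k + 1)}
    (h₁ : Sum.inr j₁ ∉ S) (h₂ : Sum.inr j₂ ∉ S) : j₁ = j₂ := by
  rcases lt_trichotomy j₁ j₂ with h | h | h
  · exact absurd hS.1 (M.subdivide_not_connected h h₁ h₂)
  · exact h
  · exact absurd hS.1 (M.subdivide_not_connected h h₂ h₁)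

variable [Finite V] [Finite E] {T : Set E}

theorem subdivide_isSpanningTree_univ_iff (he : e ∈ T) :
    (M.subdivide e k).IsSpanningTree (subdivideSet e T Set.univ) ↔ M.IsSpanningTree T := by
  have hV := M.two_le_card e
  have hTe := Set.ncard_sdiff_singleton_add_one he
  rw [IsSpanningTree, IsSpanningTree, simpleOf_connected_iff, simpleOf_connected_iff,
    ncard_subdivideSet, Nat.card_sum, Set.ncard_univ, Nat.card_fin, Nat.card_fin]
  refine and_congr (and_congr (iff_of_true ⟨.inl (M.fst e)⟩ ⟨M.fst e⟩) ⟨fun h f hf x y => ?_,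
    fun h f hf => ?_⟩) (by omega)
  · refine h (Sum.elim f fun _ => f (M.fst e)) ?_ (.inl x) (.inl y)
    rintro (t | i) ht
    · exact hf t (by simpa using ht)
    · have hfe := hf e he
      simp only [subdivide]
      split_ifs <;> simp [hfe]
  · have hf' : ∀ i : Fin (k + 1), f ((M.subdivide e k).fst (.inr i)) ↔
        f ((M.subdivide e k).snd (.inr i)) := fun i => hf _ (by simp)
    have hin : ∀ m (hm : m < k), f (.inr ⟨m, hm⟩) ↔ f (.inl (M.fst e)) := fun m hm =>
      subdivide_apply_inr_iff_fst (fun i _ => hf' i) m hm hm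
    have hfe : f (.inl (M.fst e)) ↔ f (.inl (M.snd e)) := by
      have key := hf' ⟨k, by omega⟩
      rw [subdivide_snd_last] at key
      rw [← key]
      cases k with
      | zero => rfl
      | succ k => exact (hin k (by omega)).symm
    have hV : ∀ x y, f (.inl x) ↔ f (.inl y) := h (fun v => f (.inl v)) fun t ht => by
      by_cases hte : t = e
      · rwa [hte]
      · exact hf (.inl ⟨t, hte⟩) (by simpa using ht)
    have hall : ∀ x, f x ↔ f (.inl (M.fst e)) := by
      rintro (v | m)
      · exact hV _ _
      · exact hin m m.2
    exact fun x y => (hall x).trans (hall y).symm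

theorem subdivide_isSpanningTree_compl_singleton_iff (he : e ∉ T) (j : Fin (k + 1)) :
    (M.subdivide e k).IsSpanningTree (subdivideSet e T {j}ᶜ) ↔ M.IsSpanningTree T := by
  have hV := M.two_le_card e
  have hj := Set.ncard_add_ncard_compl {j}
  rw [Set.ncard_singleton, Nat.card_fin] at hj
  rw [IsSpanningTree, IsSpanningTree, simpleOf_connected_iff, simpleOf_connected_iff,
    ncard_subdivideSet, Nat.card_sum, Nat.card_fin, Set.sdiff_singleton_eq_self he]
  refine and_congr (and_congr (iff_of_true ⟨.inl (M.fst e)⟩ ⟨M.fst e⟩) ⟨fun h f hf x y => ?_,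
    fun h f hf => ?_⟩) (by omega)
  · refine h (Sum.elim f fun m => if m.1 < j.1 then f (M.fst e) else f (M.snd e)) ?_
      (.inl x) (.inl y)
    rintro (t | i) ht
    · exact hf t (by simpa using ht)
    · have hij : i.1 ≠ j.1 := fun h => by simp [Fin.ext h] at ht
      have := i.2
      have := j.2
      simp only [subdivide]
      split_ifs <;> simp only [Sum.elim_inl, Sum.elim_inr] <;> grind
  · have hf' : ∀ i : Fin (k + 1), i ≠ j → (f ((M.subdivide e k).fst (.inr i)) ↔
        f ((M.subdivide e k).snd (.inr i))) := fun i hi => hf _ (by simpa using hi)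
    have hV : ∀ x y, f (.inl x) ↔ f (.inl y) := h (fun v => f (.inl v)) fun t ht =>
      hf (.inl ⟨t, fun h => he (h ▸ ht)⟩) (by simpa using ht)
    have hall : ∀ x, f x ↔ f (.inl (M.fst e)) := by
      rintro (v | m)
      · exact hV _ _
      · rcases lt_or_ge m.1 j.1 with hmj | hmj
        · exact subdivide_apply_inr_iff_fst (fun i hi => hf' i (Fin.ne_of_lt hi)) m m.2 hmj
        · exact (subdivide_apply_inr_iff_snd (fun i hi => hf' i (Fin.ne_of_gt hi)) m m.2 hmj).trans
            (hV _ _)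
    exact fun x y => (hall x).trans (hall y).symm

/-- The spanning trees of a subdivision missing the path edge `j`. -/
theorem setOf_subdivide_isSpanningTree_notMem (j : Fin (k + 1)) :
    {S | (M.subdivide e k).IsSpanningTree S ∧ Sum.inr j ∉ S} =
      (fun T => subdivideSet e T {j}ᶜ) '' {T | M.IsSpanningTree T ∧ e ∉ T} := by
  ext S
  constructor
  · rintro ⟨hS, hj⟩
    obtain ⟨T, he, hT⟩ := exists_eq_subdivideSet e S False
    have hB : Sum.inr ⁻¹' S = {j}ᶜ := by
      ext i
      refine ⟨fun hi hij => hj (hij ▸ hi), fun hi => ?_⟩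
      by_contra hiS
      exact hi (hS.eq_of_notMem_subdivide M hiS hj)
    rw [hB] at hT
    rw [hT, M.subdivide_isSpanningTree_compl_singleton_iff he.1] at hS
    exact ⟨T, ⟨hS, he.1⟩, hT.symm⟩
  · rintro ⟨T, ⟨hT, he⟩, rfl⟩
    exact ⟨(M.subdivide_isSpanningTree_compl_singleton_iff he j).2 hT, by simp⟩

/-- The spanning trees of a subdivision containing the whole new path. -/
theorem setOf_subdivide_isSpanningTree_forall_mem :
    {S | (M.subdivide e k).IsSpanningTree S ∧ ∀ j, Sum.inr j ∈ S} =
      (fun T => subdivideSet e T Set.univ) '' {T | M.IsSpanningTree T ∧ e ∈ T} := by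
  ext S
  constructor
  · rintro ⟨hS, hj⟩
    obtain ⟨T, he, hT⟩ := exists_eq_subdivideSet e S True
    rw [show Sum.inr ⁻¹' S = Set.univ from Set.eq_univ_of_forall hj] at hT
    rw [hT, M.subdivide_isSpanningTree_univ_iff (he.2 trivial)] at hS
    exact ⟨T, ⟨hS, he.2 trivial⟩, hT.symm⟩
  · rintro ⟨T, ⟨hT, he⟩, rfl⟩
    exact ⟨(M.subdivide_isSpanningTree_univ_iff he).2 hT, by simp⟩

theorem ncard_subdivide_isSpanningTree_notMem (j : Fin (k + 1)) :
    {S | (M.subdivide e k).IsSpanningTree S ∧ Sum.inr j ∉ S}.ncard = (M.delete e).tau := by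
  rw [setOf_subdivide_isSpanningTree_notMem, Set.InjOn.ncard_image, tau_delete]
  exact fun T hT T' hT' h => (subdivideSet_inj (iff_of_false hT.2 hT'.2) h).1

theorem ncard_subdivide_isSpanningTree_forall_mem :
    {S | (M.subdivide e k).IsSpanningTree S ∧ ∀ j, Sum.inr j ∈ S}.ncard =
      (M.contract e).tau := by
  rw [setOf_subdivide_isSpanningTree_forall_mem, Set.InjOn.ncard_image, tau_contract]
  exact fun T hT T' hT' h => (subdivideSet_inj (iff_of_true hT.2 hT'.2) h).1

variable (e)

theorem tau_delete_subdivide (i : Fin (k + 1)) :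
    ((M.subdivide e k).delete (.inr i)).tau = (M.delete e).tau := by
  rw [tau_delete, ncard_subdivide_isSpanningTree_notMem]

theorem tau_contract_subdivide (i : Fin (k + 1)) :
    ((M.subdivide e k).contract (.inr i)).tau = (M.contract e).tau + k * (M.delete e).tau := by
  have hsplit : {S | (M.subdivide e k).IsSpanningTree S ∧ Sum.inr i ∈ S} =
      {S | (M.subdivide e k).IsSpanningTree S ∧ ∀ j, Sum.inr j ∈ S} ∪
        ⋃ j : {j // j ≠ i}, {S | (M.subdivide e k).IsSpanningTree S ∧ Sum.inr j.1 ∉ S} := by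
    ext S
    simp only [Set.mem_union, Set.mem_iUnion, Set.mem_ofPred_eq]
    constructor
    · rintro ⟨hS, hi⟩
      by_cases h : ∀ j, Sum.inr j ∈ S
      · exact .inl ⟨hS, h⟩
      · obtain ⟨j, hj⟩ := not_forall.1 h
        exact .inr ⟨⟨j, fun hji => hj (hji ▸ hi)⟩, hS, hj⟩
    · rintro (⟨hS, h⟩ | ⟨j, hS, hj⟩)
      · exact ⟨hS, h i⟩
      · exact ⟨hS, by_contra fun hi => j.2 (hS.eq_of_notMem_subdivide M hj hi)⟩
  have hdisj : Disjoint {S | (M.subdivide e k).IsSpanningTree S ∧ ∀ j, Sum.inr j ∈ S}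
      (⋃ j : {j // j ≠ i}, {S | (M.subdivide e k).IsSpanningTree S ∧ Sum.inr j.1 ∉ S}) := by
    refine Set.disjoint_iUnion_right.2 fun j => Set.disjoint_left.2 ?_
    exact fun S hS hS' => hS'.2 (hS.2 j)
  rw [tau_contract, hsplit, Set.ncard_union_eq hdisj (Set.toFinite _) (Set.toFinite _),
    ncard_subdivide_isSpanningTree_forall_mem, Set.ncard_iUnion_of_finite fun _ => Set.toFinite _]
  · simp [ncard_subdivide_isSpanningTree_notMem, finsum_eq_sum_of_fintype]
  · intro j₁ j₂ hne
    refine Set.disjoint_left.2 fun S h₁ h₂ => hne (Subtype.ext ?_)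
    exact h₁.1.eq_of_notMem_subdivide M h₁.2 h₂.2

end subdivide

end Multigraph

/-- Subdivision preserves coprimality: if `(G', e')` is obtained from the marked
connected graph `(G, e)` by replacing `e` with a path of length `k+1` (marking a new
edge `e'`), then `gcd(τ(G'−e'), τ(G'/e')) = gcd(τ(G−e), τ(G/e))`. -/
theorem gcd_tau_subdivide {V E : Type} [Fintype V] [Fintype E] (M : Multigraph V E)
    (e : E) (hconn : (M.simpleOf Set.univ).Connected) (k : ℕ) (i : Fin (k + 1)) :
    Nat.gcd (((M.subdivide e k).delete (.inr i)).tau)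
        (((M.subdivide e k).contract (.inr i)).tau) =
      Nat.gcd ((M.delete e).tau) ((M.contract e).tau) := by
  rw [M.tau_delete_subdivide, M.tau_contract_subdivide, Nat.gcd_add_mul_right_right]
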